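/- Let G be a minimal counterexample, with non-inner class-preserving Coleman automorphism φ of 2-power order. Then the Frattini subgroup Φ(G) of G is a 2-group. -/

import Mathlib

/-- A finite 2-group of order `2^n` (`n ≥ 4`) is semidihedral if it is generated by
elements `a`, `b` with `a^(2^(n-1)) = 1`, `b^2 = 1` and `b⁻¹ * a * b = a^(2^(n-2) - 1)`. -/
def IsSemidihedral (S : Type*) [Group S] : Prop :=
  ∃ n : ℕ, 4 ≤ n ∧ Nat.card S = 2 ^ n ∧ ∃ a b : S,
    a ^ (2 ^ (n - 1)) = 1 ∧ b ^ 2 = 1 ∧ b⁻¹ * a * b = a ^ (2 ^ (n - 2) - 1) ∧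
    Subgroup.closure {a, b} = ⊤

/-- An automorphism is class-preserving if it maps every element to a conjugate of itself. -/
def IsClassPres {G : Type*} [Group G] (φ : MulAut G) : Prop :=
  ∀ g : G, IsConj g (φ g)

/-- An automorphism is Coleman if its restriction to every Sylow subgroup is given by
conjugation by some element of the group. -/
def IsColemanAut {G : Type*} [Group G] (φ : MulAut G) : Prop :=
  ∀ p : ℕ, p.Prime → ∀ P : Sylow p G, ∃ x : G, ∀ u ∈ (P : Subgroup G), φ u = x⁻¹ * u * x

/-- An automorphism is inner if it is conjugation by some group element. -/
def IsInnerAut {G : Type*} [Group G] (φ : MulAut G) : Prop :=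
  ∃ g : G, φ = MulAut.conj g

universe u

/-- `G`, with automorphism `φ`, is a minimal counterexample: `G` is a finite group with
semidihedral Sylow 2-subgroups, `φ` is a non-inner class-preserving Coleman automorphism
of `G` of 2-power order, and every finite group of smaller order with semidihedral Sylow
2-subgroups admits no non-inner class-preserving Coleman automorphism of 2-power order. -/
def IsMinimalCounterexample (G : Type u) [Group G] [Finite G] (φ : MulAut G) : Prop :=
  (∀ S : Sylow 2 G, IsSemidihedral (S : Subgroup G)) ∧
  ¬ IsInnerAut φ ∧ (∃ k : ℕ, orderOf φ = 2 ^ k) ∧ IsClassPres φ ∧ IsColemanAut φ ∧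
  ∀ (H : Type u) [Group H] [Finite H], Nat.card H < Nat.card G →
    (∀ S : Sylow 2 H, IsSemidihedral (S : Subgroup H)) →
    ∀ ψ : MulAut H, (∃ k : ℕ, orderOf ψ = 2 ^ k) → IsClassPres ψ → IsColemanAut ψ →
      IsInnerAut ψ

/-- The property of being semidihedral is invariant under isomorphism. -/
theorem IsSemidihedral.of_mulEquiv {S T : Type*} [Group S] [Group T] (e : S ≃* T)
    (h : IsSemidihedral S) : IsSemidihedral T := by
  obtain ⟨n, hn, hcard, a, b, ha, hb, hab, hgen⟩ := h
  refine ⟨n, hn, by rw [← hcard, Nat.card_congr e.toEquiv], e a, e b, ?_, ?_, ?_, ?_⟩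
  · rw [← map_pow, ha, map_one]
  · rw [← map_pow, hb, map_one]
  · rw [← map_pow, ← hab, map_mul, map_mul, map_inv]
  · have h := MonoidHom.map_closure e.toMonoidHom {a, b}
    rw [hgen, Subgroup.map_top_of_surjective _ e.surjective, Set.image_pair] at h
    exact h.symm

/-- Conjugating an inner automorphism by an arbitrary automorphism gives an inner one. -/
theorem normal_range_mulAut_conj (G : Type*) [Group G] :
    (MulAut.conj : G →* MulAut G).range.Normal := by
  refine ⟨?_⟩
  rintro _ ⟨g, rfl⟩ α
  refine ⟨α g, ?_⟩
  ext x
  simp [MulAut.conj_apply]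

theorem isInnerAut_iff_mem_range {G : Type*} [Group G] {φ : MulAut G} :
    IsInnerAut φ ↔ φ ∈ (MulAut.conj : G →* MulAut G).range :=
  ⟨fun ⟨g, hg⟩ ↦ ⟨g, hg.symm⟩, fun ⟨g, hg⟩ ↦ ⟨g, hg.symm⟩⟩

/-- A class-preserving automorphism stabilises every normal subgroup. -/
theorem IsClassPres.map_eq {G : Type*} [Group G] [Finite G] {φ : MulAut G} (hφ : IsClassPres φ)
    (N : Subgroup G) [N.Normal] : N.map (φ : G →* G) = N := by
  refine Subgroup.eq_of_le_of_card_ge ?_ ?_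
  · rintro _ ⟨x, hx, rfl⟩
    obtain ⟨c, hc⟩ := isConj_iff.1 (hφ x)
    change φ x ∈ N
    rw [← hc]
    exact Subgroup.Normal.conj_mem inferInstance x hx c
  · exact (Subgroup.card_map_of_injective (f := (φ : G →* G)) φ.injective).ge

theorem congr_pow_mk {G : Type*} [Group G] (N : Subgroup G) [N.Normal] (φ : MulAut G)
    (h : N.map (φ : G →* G) = N) (n : ℕ) (x : G) :
    ((QuotientGroup.congr N N φ h : MulAut (G ⧸ N)) ^ n) (x : G ⧸ N) = ((φ ^ n) x : G) := by
  induction n generalizing x with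
  | zero => rfl
  | succ k ih =>
    rw [pow_succ, pow_succ, MulAut.mul_apply, MulAut.mul_apply, ← ih]
    rfl

theorem IsClassPres.congr {G : Type*} [Group G] {φ : MulAut G} (hφ : IsClassPres φ)
    (N : Subgroup G) [N.Normal] (h : N.map (φ : G →* G) = N) :
    IsClassPres (QuotientGroup.congr N N φ h : MulAut (G ⧸ N)) := by
  intro q
  obtain ⟨x, rfl⟩ := QuotientGroup.mk_surjective q
  exact MonoidHom.map_isConj (QuotientGroup.mk' N) (hφ x)

theorem IsColemanAut.congr {G : Type*} [Group G] [Finite G] {φ : MulAut G}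
    (hφ : IsColemanAut φ) (N : Subgroup G) [N.Normal] (h : N.map (φ : G →* G) = N) :
    IsColemanAut (QuotientGroup.congr N N φ h : MulAut (G ⧸ N)) := by
  intro p hp Q
  have : Fact p.Prime := ⟨hp⟩
  obtain ⟨P, rfl⟩ := Sylow.mapSurjective_surjective (QuotientGroup.mk'_surjective N) p Q
  obtain ⟨x, hx⟩ := hφ p hp P
  refine ⟨(x : G ⧸ N), ?_⟩
  rintro _ ⟨u, hu, rfl⟩
  exact congrArg (QuotientGroup.mk' N) (hx u hu)

/-- Sylow `p`-subgroups are unchanged in the quotient by a normal subgroup of order prime to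
`p`. -/
theorem Sylow.nonempty_mulEquiv_of_quotient {G : Type*} [Group G] [Finite G] {p : ℕ}
    [Fact p.Prime] (N : Subgroup G) [N.Normal] (hN : ¬ p ∣ Nat.card N) (Q : Sylow p (G ⧸ N)) :
    ∃ P : Sylow p G, Nonempty (P ≃* Q) := by
  obtain ⟨P, rfl⟩ := Sylow.mapSurjective_surjective (QuotientGroup.mk'_surjective N) p Q
  obtain ⟨n, hn⟩ := P.2.exists_card_eq
  have hdisj : Disjoint (P : Subgroup G) N := Subgroup.disjoint_of_coprime_natCard <| by
    rw [hn]
    exact ((Fact.out : p.Prime).coprime_iff_not_dvd.2 hN).pow_left n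
  have hinj : Function.Injective ((QuotientGroup.mk' N).subgroupMap (P : Subgroup G)) := by
    rw [injective_iff_map_eq_one]
    rintro ⟨x, hx⟩ hx1
    have hxN : x ∈ N := (QuotientGroup.eq_one_iff x).1 (congrArg Subtype.val hx1)
    exact Subtype.ext (Subgroup.disjoint_def.1 hdisj hx hxN)
  exact ⟨P, ⟨MulEquiv.ofBijective _ ⟨hinj, MonoidHom.subgroupMap_surjective _ _⟩⟩⟩

/-- An automorphism of `p`-power order acting trivially modulo a normal subgroup `N` of order
prime to `p` fixes a representative of every coset of `N`. -/
theorem exists_fixed_mk_eq {G : Type*} [Group G] [Finite G] {p : ℕ} [Fact p.Prime]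
    (N : Subgroup G) [N.Normal] (hN : ¬ p ∣ Nat.card N) {σ : MulAut G} {k : ℕ}
    (hσ : σ ^ p ^ k = 1) (htriv : ∀ x : G, ((σ x : G) : G ⧸ N) = x) (g : G) :
    ∃ x : G, σ x = x ∧ (x : G ⧸ N) = g := by
  let Z := Subgroup.zpowers σ
  have hZ : IsPGroup p Z := by
    obtain ⟨m, -, hm⟩ := (Nat.dvd_prime_pow Fact.out).1 (orderOf_dvd_of_pow_eq_one hσ)
    exact IsPGroup.of_card ((Nat.card_zpowers σ).trans hm)
  let F : Subgroup (MulAut G) :=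
    { carrier := {τ | ∀ x : G, ((τ x : G) : G ⧸ N) = x}
      one_mem' := fun _ ↦ rfl
      mul_mem' := fun {a b} ha hb x ↦ (ha (b x)).trans (hb x)
      inv_mem' := fun {a} ha x ↦ by
        have h := ha (a⁻¹ x)
        rw [MulAut.apply_inv_self] at h
        exact h.symm }
  have hZF : Z ≤ F := (Subgroup.zpowers_le).2 htriv
  let C : SubMulAction Z G :=
    { carrier := {x | (x : G ⧸ N) = g}
      smul_mem' := fun τ x hx ↦ (hZF τ.2 x).trans hx }
  have hC : Nat.card C = Nat.card N := by
    have e := (QuotientGroup.mk' N).fiberEquivKer g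
    rw [QuotientGroup.ker_mk'] at e
    exact Nat.card_congr e
  obtain ⟨x, hx⟩ := hZ.nonempty_fixed_point_of_prime_not_dvd_card C (hC ▸ hN)
  exact ⟨x, congrArg Subtype.val (hx ⟨σ, Subgroup.mem_zpowers σ⟩), x.2⟩

/-- An automorphism of `p`-power order acting trivially modulo a normal subgroup `N ≤ Φ(G)` of
order prime to `p` is trivial. -/
theorem eq_one_of_trivial_mod_le_frattini {G : Type*} [Group G] [Finite G] {p : ℕ}
    [Fact p.Prime] (N : Subgroup G) [N.Normal] (hN : ¬ p ∣ Nat.card N) (hle : N ≤ frattini G)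
    {σ : MulAut G} {k : ℕ} (hσ : σ ^ p ^ k = 1)
    (htriv : ∀ x : G, ((σ x : G) : G ⧸ N) = x) : σ = 1 := by
  let K : Subgroup G := (σ : G →* G).eqLocus (MonoidHom.id G)
  have hK : K = ⊤ := by
    refine frattini_nongenerating (eq_top_iff.2 fun g _ ↦ ?_)
    obtain ⟨x, hx, hxg⟩ := exists_fixed_mk_eq N hN hσ htriv g
    have h := Subgroup.mul_mem_sup (show x ∈ K from hx) (hle (QuotientGroup.eq.1 hxg))
    rwa [mul_inv_cancel_left] at h
  ext x
  exact (hK ▸ Subgroup.mem_top x : x ∈ K)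

/-- A minimal counterexample has no nontrivial normal subgroup of odd order inside its Frattini
subgroup. -/
theorem IsMinimalCounterexample.eq_bot_of_le_frattini {G : Type u} [Group G] [Finite G]
    {φ : MulAut G} (hmin : IsMinimalCounterexample G φ) (N : Subgroup G) [N.Normal]
    (hodd : ¬ 2 ∣ Nat.card N) (hle : N ≤ frattini G) : N = ⊥ := by
  obtain ⟨hsyl, hinner, ⟨k, hk⟩, hclass, hcol, hsmall⟩ := hmin
  by_contra hbot
  apply hinner
  have hN := hclass.map_eq N
  have hφk : φ ^ 2 ^ k = 1 := hk ▸ pow_orderOf_eq_one φ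
  have hcard : Nat.card (G ⧸ N) < Nat.card G := by
    rw [N.card_eq_card_quotient_mul_card_subgroup]
    exact lt_mul_of_one_lt_right Nat.card_pos (N.one_lt_card_iff_ne_bot.2 hbot)
  obtain ⟨q, hq⟩ := hsmall (G ⧸ N) hcard
    (fun S ↦ by
      obtain ⟨P, ⟨e⟩⟩ := Sylow.nonempty_mulEquiv_of_quotient N hodd S
      exact (hsyl P).of_mulEquiv e)
    (QuotientGroup.congr N N φ hN)
    (by
      have h : (QuotientGroup.congr N N φ hN : MulAut (G ⧸ N)) ^ 2 ^ k = 1 := by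
        ext q
        obtain ⟨x, rfl⟩ := QuotientGroup.mk_surjective q
        rw [congr_pow_mk, hφk]
        rfl
      obtain ⟨m, -, hm⟩ := (Nat.dvd_prime_pow Nat.prime_two).1 (orderOf_dvd_of_pow_eq_one h)
      exact ⟨m, hm⟩)
    (hclass.congr N hN) (hcol.congr N hN)
  obtain ⟨g, rfl⟩ := QuotientGroup.mk_surjective q
  set θ : MulAut G := (MulAut.conj g)⁻¹ * φ with hθ
  have hθtriv : ∀ (n : ℕ) (x : G), (((θ ^ n) x : G) : G ⧸ N) = x := by
    intro n
    induction n with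
    | zero => exact fun _ ↦ rfl
    | succ n ih =>
      intro x
      have hx : ((φ x : G) : G ⧸ N) = g * x * (g : G ⧸ N)⁻¹ :=
        DFunLike.congr_fun hq (x : G ⧸ N)
      rw [pow_succ, MulAut.mul_apply, ih, hθ, MulAut.mul_apply, MulAut.conj_inv_apply]
      simp only [QuotientGroup.mk_mul, QuotientGroup.mk_inv, hx]
      group
  obtain ⟨a, m, hm, hord⟩ := Nat.exists_eq_two_pow_mul_odd (orderOf_pos θ).ne'
  have hθm : θ ^ m = 1 := by
    refine eq_one_of_trivial_mod_le_frattini (p := 2) (k := a) N hodd hle ?_ (hθtriv m)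
    rw [← pow_mul, mul_comm, ← hord, pow_orderOf_eq_one]
  have := normal_range_mulAut_conj G
  rw [isInnerAut_iff_mem_range, ← QuotientGroup.eq_one_iff]
  set π := QuotientGroup.mk' (MulAut.conj : G →* MulAut G).range
  have hπ : π φ = π θ := by
    have h1 : π (MulAut.conj g) = 1 := (QuotientGroup.eq_one_iff _).2 ⟨g, rfl⟩
    rw [hθ, map_mul, map_inv, h1, inv_one, one_mul]
  have h2 : π φ ^ 2 ^ k = 1 := by rw [← map_pow, hφk, map_one]
  have hm1 : π φ ^ m = 1 := by rw [hπ, ← map_pow, hθm, map_one]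
  have hcop : Nat.gcd (2 ^ k) m = 1 := hm.coprime_two_left.pow_left k
  have := pow_gcd_eq_one.2 ⟨h2, hm1⟩
  rwa [hcop, pow_one] at this

/-- In a minimal counterexample, the Frattini subgroup is a 2-group. -/
theorem stmt_14 (G : Type u) [Group G] [Finite G] (φ : MulAut G)
    (hmin : IsMinimalCounterexample G φ) :
    IsPGroup 2 (frattini G) := by
  have hpow : Nat.card (frattini G) = 2 ^ (Nat.card (frattini G)).primeFactorsList.length := by
    refine Nat.eq_prime_pow_of_unique_prime_dvd Nat.card_pos.ne' fun {p} hp hdvd ↦ ?_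
    by_contra hp2
    have : Fact p.Prime := ⟨hp⟩
    have hnil : Group.IsNilpotent (frattini G) := frattini_nilpotent
    let P : Sylow p (frattini G) := default
    have := P.characteristic_of_normal inferInstance
    have hcard : Nat.card ((P : Subgroup (frattini G)).map (frattini G).subtype) = Nat.card P :=
      Subgroup.card_map_of_injective (frattini G).subtype_injective
    have hbot := hmin.eq_bot_of_le_frattini ((P : Subgroup (frattini G)).map (frattini G).subtype)
      (by
        obtain ⟨n, hn⟩ := P.2.exists_card_eq
        rw [hcard, hn]
        exact fun h ↦ hp2 ((Nat.prime_dvd_prime_iff_eq Nat.prime_two hp).1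
          (Nat.prime_two.dvd_of_dvd_pow h)).symm)
      (Subgroup.map_subtype_le _)
    rw [hbot, Subgroup.card_bot] at hcard
    exact hp.one_lt.not_ge (hcard ▸ Nat.le_of_dvd Nat.card_pos (P.dvd_card_of_dvd_card hdvd))
  exact IsPGroup.of_card hpow
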